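/- Let p, q be integers with q ≥ 1, 0 ≤ p < q and gcd(p,q) = 1. Then there are exactly q rotation sets for m_3 with rotation number p/q (mod ℤ) which are the union of two distinct periodic orbits of m_3; that is, the collection of such sets has cardinality q. -/

import Mathlib

open Set MeasureTheory ENNReal

noncomputable section

instance : Fact ((0:ℝ) < 1) := ⟨one_pos⟩

/-- The circle `ℝ/ℤ`. -/
abbrev Circle1 : Type := AddCircle (1 : ℝ)

/-- The multiplication-by-`d` map `m_d` on the circle. -/
def md (d : ℕ) : Circle1 → Circle1 := fun t => d • t

/-- `G : ℝ → ℝ` (monotone, commuting with `x ↦ x + 1`) is a lift of the circle map `g`. -/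
def IsLift (g : Circle1 → Circle1) (G : CircleDeg1Lift) : Prop :=
  ∀ x : ℝ, g ((x : ℝ) : Circle1) = ((G x : ℝ) : Circle1)

/-- `g` is a monotone degree-one circle map. -/
def IsMonotoneDeg1 (g : Circle1 → Circle1) : Prop :=
  ∃ G : CircleDeg1Lift, IsLift g G

/-- `ρ` is the rotation number of the monotone degree-one circle map `g`:
the residue class mod `ℤ` of the translation number of a lift of `g`. -/
def HasRotationNumber (g : Circle1 → Circle1) (ρ : Circle1) : Prop :=
  ∃ G : CircleDeg1Lift, IsLift g G ∧ ρ = ((G.translationNumber : ℝ) : Circle1)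

/-- `X` is a rotation set for `m_d`. -/
def IsRotationSet (d : ℕ) (X : Set Circle1) : Prop :=
  X.Nonempty ∧ IsCompact X ∧ md d '' X = X ∧
    ∃ g : Circle1 → Circle1, IsMonotoneDeg1 g ∧ ∀ t ∈ X, g t = md d t

/-- `X` is a rotation set for `m_d` with rotation number `ρ`. -/
def IsRotationSetWith (d : ℕ) (X : Set Circle1) (ρ : Circle1) : Prop :=
  X.Nonempty ∧ IsCompact X ∧ md d '' X = X ∧
    ∃ g : Circle1 → Circle1, (∀ t ∈ X, g t = md d t) ∧ HasRotationNumber g ρ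

/-- A gap of `X` is a connected component of the complement of `X`. -/
def IsGap (X : Set Circle1) (I : Set Circle1) : Prop :=
  ∃ t ∈ Xᶜ, I = connectedComponentIn Xᶜ t

/-- `C` is a periodic orbit (cycle) of `m_d`. -/
def IsPeriodicOrbit (d : ℕ) (C : Set Circle1) : Prop :=
  ∃ (t : Circle1) (n : ℕ), 0 < n ∧ (md d)^[n] t = t ∧
    C = Set.range (fun k : Fin n => (md d)^[(k : ℕ)] t)

/-- The number of points of `X` whose representative in `[0,1)` lies in `[0,1/2)`. -/
def s1 (X : Set Circle1) : ℕ :=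
  {t ∈ X | ((AddCircle.equivIco 1 0 t : ℝ) < 1 / 2)}.ncard


structure Cfg (p q : ℕ) (x : ℤ → ℝ) (N : ℤ → ℤ) : Prop where
  mono : StrictMono x
  per : ∀ i, x (i + 2 * q) = x i + 1
  eqn : ∀ i, 3 * x i = x (i + 2 * p) + N i
  neg : x (-1) < 0
  nonneg : 0 ≤ x 0

lemma per_int {m : ℤ} {x : ℤ → ℝ} (h : ∀ i, x (i + m) = x i + 1) (i n : ℤ) :
    x (i + m * n) = x i + n := by
  induction n using Int.induction_on with
  | zero => simp
  | succ k ih =>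
    have := h (i + m * k)
    rw [show i + m * ((k:ℤ) + 1) = i + m * k + m by ring, this, ih]; push_cast; ring
  | pred k ih =>
    have := h (i + m * (-(k:ℤ) - 1))
    rw [show i + m * (-(k:ℤ) - 1) + m = i + m * (-(k:ℤ)) by ring, ih] at this
    push_cast at *; linarith

lemma cop_hit {p q : ℕ} (hq : 1 ≤ q) (hcop : Nat.Coprime p q) (r : ℤ) :
    ∃ k : ℕ, k < q ∧ ∃ l : ℤ, r = p * k + q * l := by
  obtain ⟨u, v, huv⟩ := (Nat.isCoprime_iff_coprime.mpr hcop : IsCoprime (p:ℤ) (q:ℤ))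
  have hq' : (0:ℤ) < q := by exact_mod_cast hq
  have h0 := Int.emod_nonneg (r * u) hq'.ne'
  have h1 := Int.emod_lt_of_pos (r * u) hq'
  refine ⟨((r * u) % q).toNat, by omega, r * v + p * ((r * u) / q), ?_⟩
  rw [Int.toNat_of_nonneg h0]
  have := Int.emod_add_mul_ediv (r * u) q
  have e : (r * u) % q = r * u - q * ((r * u) / q) := by linarith
  rw [e]
  linear_combination (-r) * huv

lemma shift_of {φ : ℤ → ℤ} (hm : StrictMono φ) (hs : Function.Surjective φ) (i : ℤ) :
    φ i = i + φ 0 := by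
  have step : ∀ i, φ (i + 1) = φ i + 1 := by
    intro i
    obtain ⟨j, hj⟩ := hs (φ i + 1)
    have h1 : φ i < φ j := by omega
    have h2 : i < j := hm.lt_iff_lt.mp h1
    have h3 := hm.monotone (show i + 1 ≤ j by omega)
    have h4 := hm (show i < i + 1 by omega)
    omega
  induction i using Int.induction_on with
  | zero => simp
  | succ k ih => rw [step, ih]; ring
  | pred k ih =>
    have := step (-(k:ℤ) - 1)
    rw [show -(k:ℤ) - 1 + 1 = -(k:ℤ) by ring] at this
    omega

lemma circ_eq_iff (a b : ℝ) : (a : Circle1) = (b : Circle1) ↔ ∃ n : ℤ, a = b + n := by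
  rw [← sub_eq_zero, ← AddCircle.coe_sub, AddCircle.coe_eq_zero_iff]
  constructor
  · rintro ⟨n, hn⟩
    refine ⟨n, ?_⟩
    simp at hn; linarith
  · rintro ⟨n, hn⟩
    refine ⟨n, ?_⟩
    simp; linarith

/-- uniqueness of normalized enumerations -/
lemma enum_unique {x y : ℤ → ℝ} (hx : StrictMono x) (hy : StrictMono y)
    (hxy : ∀ i, ∃ j, x i = y j) (hyx : ∀ j, ∃ i, x i = y j)
    (hx1 : x (-1) < 0) (hx0 : 0 ≤ x 0) (hy1 : y (-1) < 0) (hy0 : 0 ≤ y 0) : x = y := by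
  choose φ hφ using hxy
  have hm : StrictMono φ := by
    intro i j hij
    have := hx hij
    rw [hφ, hφ] at this
    exact hy.lt_iff_lt.mp this
  have hs : Function.Surjective φ := by
    intro j
    obtain ⟨i, hi⟩ := hyx j
    exact ⟨i, hy.injective (by rw [← hφ, hi])⟩
  have hsh := shift_of hm hs
  have h0 : φ 0 = 0 := by
    rcases lt_trichotomy (φ 0) 0 with h | h | h
    · have := hy.monotone (show φ 0 ≤ -1 by omega)
      rw [← hφ] at this; linarith
    · exact h
    · have h1 := hsh (-1)
      have := hy.monotone (show 0 ≤ φ (-1) by omega)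
      rw [← hφ] at this; linarith
  funext i
  rw [hφ, hsh, h0, add_zero]

/-- enumeration -/
lemma enum_exists (X : Set Circle1) (hX : X.Finite) (hne : X.Nonempty) :
    ∃ (m : ℕ) (x : ℤ → ℝ), 0 < m ∧ StrictMono x ∧ (∀ i, x (i + m) = x i + 1) ∧ x (-1) < 0 ∧
      0 ≤ x 0 ∧ ∀ y : ℝ, (y : Circle1) ∈ X ↔ ∃ i, x i = y := by
  classical
  let S : Finset ℝ := (hX.image (fun t => ((AddCircle.equivIco 1 0 t : Set.Ico (0:ℝ) (0+1)) : ℝ))).toFinset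
  have hS : ∀ y, y ∈ S ↔ (0 ≤ y ∧ y < 1 ∧ (y : Circle1) ∈ X) := by
    intro y
    simp only [S, Set.Finite.mem_toFinset, Set.mem_image]
    constructor
    · rintro ⟨t, ht, rfl⟩
      have := (AddCircle.equivIco 1 0 t).2
      refine ⟨this.1, by simpa using this.2, ?_⟩
      rw [AddCircle.coe_equivIco]; exact ht
    · rintro ⟨h0, h1, h2⟩
      refine ⟨y, h2, ?_⟩
      rw [AddCircle.equivIco_coe_eq (p := 1) (a := 0) ⟨h0, by simpa using h1⟩]
  obtain ⟨m, hm⟩ : ∃ m, S.card = m := ⟨_, rfl⟩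
  have hSne : S.Nonempty := by
    obtain ⟨t, ht⟩ := hne
    exact ⟨_, (Set.Finite.mem_toFinset _).mpr ⟨t, ht, rfl⟩⟩
  have hmpos : 0 < m := by rw [← hm]; exact hSne.card_pos
  let e := S.orderEmbOfFin hm
  have heS : ∀ a, e a ∈ S := fun a => S.orderEmbOfFin_mem hm a
  have hmz : (0:ℤ) < m := by exact_mod_cast hmpos
  have hlt : ∀ i : ℤ, (i % m).toNat < m := by
    intro i
    have h0 := Int.emod_nonneg i hmz.ne'
    have h1 := Int.emod_lt_of_pos i hmz
    omega
  let x : ℤ → ℝ := fun i => e ⟨(i % m).toNat, hlt i⟩ + ((i / m : ℤ) : ℝ)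
  have hb : ∀ i, ((i / m : ℤ) : ℝ) ≤ x i ∧ x i < ((i / m : ℤ) : ℝ) + 1 := by
    intro i
    have := (hS _).1 (heS ⟨(i % m).toNat, hlt i⟩)
    simp only [x]
    constructor <;> linarith [this.1, this.2.1]
  refine ⟨m, x, hmpos, ?_, ?_, ?_, ?_, ?_⟩
  · intro i j hij
    have hle : i / m ≤ j / m := Int.ediv_le_ediv hmz hij.le
    rcases hle.lt_or_eq with h | h
    · have h' : ((i / m : ℤ) : ℝ) + 1 ≤ ((j / m : ℤ) : ℝ) := by exact_mod_cast h
      linarith [(hb i).2, (hb j).1]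
    · have h1 := Int.emod_add_mul_ediv i m
      have h2 := Int.emod_add_mul_ediv j m
      rw [h] at h1
      have h0 := Int.emod_nonneg i hmz.ne'
      have : (i % m).toNat < (j % m).toNat := by omega
      simp only [x, h]
      have := e.strictMono (show (⟨(i % m).toNat, hlt i⟩ : Fin m) < ⟨(j % m).toNat, hlt j⟩ from this)
      linarith
  · intro i
    have h1 : (i + m) / (m:ℤ) = i / m + 1 := by rw [Int.add_ediv_of_dvd_right dvd_rfl, Int.ediv_self hmz.ne']
    have h2 : (i + m) % (m:ℤ) = i % m := by simp
    simp only [x, h1, h2]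
    push_cast; ring
  · have h : (-1 : ℤ) / m = -1 := by
      rw [Int.ediv_eq_iff_of_pos hmz] <;> omega
    have := (hb (-1)).2
    rw [h] at this; push_cast at this; linarith
  · have := (hb 0).1
    simpa using this
  · intro y
    constructor
    · intro hy
      have : Int.fract y ∈ S := by
        rw [hS]
        refine ⟨Int.fract_nonneg y, Int.fract_lt_one y, ?_⟩
        have : ((Int.fract y : ℝ) : Circle1) = y := (circ_eq_iff _ _).2 ⟨-⌊y⌋, by rw [Int.fract]; push_cast; ring⟩
        rw [this]; exact hy
      have : Int.fract y ∈ Set.range e := by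
        rw [Finset.range_orderEmbOfFin]; exact this
      obtain ⟨⟨a, ha⟩, hae⟩ := this
      refine ⟨a + m * ⌊y⌋, ?_⟩
      have h1 : ((a:ℤ) + m * ⌊y⌋) / (m:ℤ) = ⌊y⌋ := by
        rw [Int.add_mul_ediv_left _ _ hmz.ne', Int.ediv_eq_zero_of_lt (by omega) (by omega)]; simp
      have h2 : ((a:ℤ) + m * ⌊y⌋) % (m:ℤ) = a := by
        rw [Int.add_mul_emod_self_left, Int.emod_eq_of_lt (by omega) (by omega)]
      simp only [x, h1, h2, Int.toNat_natCast, hae]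
      exact Int.fract_add_floor y
    · rintro ⟨i, rfl⟩
      have h := ((hS _).1 (heS ⟨(i % m).toNat, hlt i⟩)).2.2
      have : ((x i : ℝ) : Circle1) = (e ⟨(i % m).toNat, hlt i⟩ : ℝ) := (circ_eq_iff _ _).2 ⟨i / m, rfl⟩
      rw [this]; exact h

def Nc (q c : ℕ) (i : ℤ) : ℤ := i / (2 * q) + (i - 2 * c - 1) / (2 * q) + 1

def xc (p q c : ℕ) (i : ℤ) : ℝ :=
  (p + ∑ k ∈ Finset.range q, (3:ℝ) ^ (q - 1 - k) * (Nc q c (i + 2 * p * k) : ℝ)) / (3 ^ q - 1)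

lemma Nc_per {q c : ℕ} (hq : 1 ≤ q) (i n : ℤ) : Nc q c (i + 2 * q * n) = Nc q c i + 2 * n := by
  have hq' : (2 * q : ℤ) ≠ 0 := by omega
  unfold Nc
  rw [show i + 2 * q * n - 2 * c - 1 = (i - 2 * c - 1) + 2 * q * n by ring,
    Int.add_mul_ediv_left _ _ hq', Int.add_mul_ediv_left _ _ hq']
  ring

lemma Nc_mono {q c : ℕ} (hq : 1 ≤ q) : Monotone (Nc q c) := by
  intro i j hij
  have hq' : (0 : ℤ) < 2 * q := by omega
  unfold Nc
  have h1 := Int.ediv_le_ediv hq' hij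
  have h2 := Int.ediv_le_ediv hq' (show i - 2 * c - 1 ≤ j - 2 * c - 1 by omega)
  omega

lemma Nc_low {q c : ℕ} (hc : c < q) {i : ℤ} (h0 : 0 ≤ i) (h1 : i ≤ 2 * c) : Nc q c i = 0 := by
  have hq' : (0 : ℤ) < 2 * q := by omega
  unfold Nc
  have h : (i - 2 * c - 1) / (2 * q : ℤ) = -1 := by
    rw [Int.ediv_eq_iff_of_pos hq']; omega
  rw [Int.ediv_eq_zero_of_lt h0 (by omega), h]
  rfl

lemma Nc_high {q c : ℕ} (_hc : c < q) {i : ℤ} (h0 : 2 * c < i) (h1 : i < 2 * q) : Nc q c i = 1 := by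
  unfold Nc
  rw [Int.ediv_eq_zero_of_lt (by omega) (by omega), Int.ediv_eq_zero_of_lt (by omega) (by omega)]
  rfl

lemma Nc_neg_one {q c : ℕ} (hc : c < q) : Nc q c (-1) = -1 := by
  have := Nc_per (c := c) (show 1 ≤ q by omega) (-1) 1
  rw [Nc_high hc (by omega) (by omega)] at this
  omega

lemma three_pow_pos {q : ℕ} (hq : 1 ≤ q) : (0:ℝ) < 3 ^ q - 1 := by
  have : (1:ℝ) < 3 ^ q := one_lt_pow₀ (by norm_num) (by omega)
  linarith

lemma cfg_c {p q c : ℕ} (hq : 1 ≤ q) (hpq : p < q) (hcop : Nat.Coprime p q) (hc : c < q) :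
    Cfg p q (xc p q c) (Nc q c) := by
  have hD := three_pow_pos hq
  have per : ∀ i, xc p q c (i + 2 * q) = xc p q c i + 1 := by
    intro i
    unfold xc
    have : ∀ k : ℕ, Nc q c (i + 2 * q + 2 * p * k) = Nc q c (i + 2 * p * k) + 2 := by
      intro k
      have := Nc_per (c := c) hq (i + 2 * p * k) 1
      rw [show i + 2 * q + 2 * p * k = i + 2 * p * k + 2 * q * 1 by ring, this]; ring
    simp only [this]
    push_cast
    simp only [mul_add, Finset.sum_add_distrib, ← Finset.sum_mul]
    rw [Finset.sum_range_reflect (fun k => (3:ℝ) ^ k) q, geom_sum_eq (by norm_num)]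
    field_simp
    ring
  have eqn : ∀ i, 3 * xc p q c i = xc p q c (i + 2 * p) + Nc q c i := by
    intro i
    unfold xc
    have e1 : 3 * ∑ k ∈ Finset.range q, (3:ℝ) ^ (q - 1 - k) * (Nc q c (i + 2 * p * k) : ℝ)
        = ∑ k ∈ Finset.range q, (3:ℝ) ^ (q - k) * (Nc q c (i + 2 * p * k) : ℝ) := by
      rw [Finset.mul_sum]
      refine Finset.sum_congr rfl fun k hk => ?_
      have := Finset.mem_range.1 hk
      rw [show q - k = (q - 1 - k) + 1 by omega, pow_succ]; ring
    have e2 : ∑ k ∈ Finset.range q, (3:ℝ) ^ (q - 1 - k) * (Nc q c (i + 2 * p + 2 * p * k) : ℝ)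
        = ∑ k ∈ Finset.range q, (3:ℝ) ^ (q - (k + 1)) * (Nc q c (i + 2 * p * (k + 1 : ℕ)) : ℝ) := by
      refine Finset.sum_congr rfl fun k hk => ?_
      rw [show q - (k + 1) = q - 1 - k by omega]
      congr 3; push_cast; ring
    have e3 := Finset.sum_range_succ' (fun k : ℕ => (3:ℝ) ^ (q - k) * (Nc q c (i + 2 * p * k) : ℝ)) q
    rw [Finset.sum_range_succ] at e3
    have e4 : Nc q c (i + 2 * p * q) = Nc q c i + 2 * p := by
      rw [← Nc_per hq i p]; congr 1; ring
    rw [e4] at e3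
    rw [e2]
    simp only [Nat.sub_self, Nat.sub_zero, Nat.cast_zero, mul_zero, add_zero, pow_zero, one_mul] at e3
    push_cast at e3 e1 ⊢
    field_simp
    linear_combination e1 + e3
  have mono : StrictMono (xc p q c) := by
    refine strictMono_int_of_lt_succ fun i => ?_
    unfold xc
    refine (div_lt_div_iff_of_pos_right hD).2 ?_
    refine add_lt_add_right (Finset.sum_lt_sum ?_ ?_) _
    · intro k _
      refine mul_le_mul_of_nonneg_left ?_ (by positivity)
      exact_mod_cast Nc_mono hq (by omega)
    · have key : ∃ k : ℕ, k < q ∧ Nc q c (i + 2 * p * k) < Nc q c (i + 1 + 2 * p * k) := by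
        rcases Int.even_or_odd' i with ⟨r, hr | hr⟩
        · obtain ⟨k, hk, l, hl⟩ := cop_hit hq hcop (c - r)
          refine ⟨k, hk, ?_⟩
          have a1 := Nc_per (c := c) hq (2 * c) (-l)
          have a2 := Nc_per (c := c) hq (2 * c + 1) (-l)
          rw [Nc_low hc (i := 2 * c) (by omega) (by omega)] at a1
          rw [Nc_high hc (i := 2 * c + 1) (by omega) (by omega)] at a2
          rw [show i + 2 * p * k = 2 * c + 2 * q * (-l) by linear_combination hr - 2 * hl,
            show i + 1 + 2 * p * k = 2 * c + 1 + 2 * q * (-l) by linear_combination hr - 2 * hl]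
          omega
        · obtain ⟨k, hk, l, hl⟩ := cop_hit hq hcop (-1 - r)
          refine ⟨k, hk, ?_⟩
          have a1 := Nc_per (c := c) hq (-1) (-l)
          have a2 := Nc_per (c := c) hq 0 (-l)
          rw [Nc_neg_one hc] at a1
          rw [Nc_low hc (i := 0) (by omega) (by omega)] at a2
          rw [show i + 2 * p * k = -1 + 2 * q * (-l) by linear_combination hr - 2 * hl,
            show i + 1 + 2 * p * k = 0 + 2 * q * (-l) by linear_combination hr - 2 * hl]
          omega
      obtain ⟨k, hk, h⟩ := key
      refine ⟨k, Finset.mem_range.2 hk, ?_⟩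
      refine mul_lt_mul_of_pos_left ?_ (by positivity)
      exact_mod_cast h
  refine ⟨mono, per, eqn, ?_, ?_⟩
  · have h1 := eqn (-1)
    rw [Nc_neg_one hc] at h1
    have h2 := per (-1)
    have h3 := mono (show (-1 : ℤ) + 2 * p < -1 + 2 * q by omega)
    push_cast at h1
    linarith
  · unfold xc
    refine div_nonneg (add_nonneg (by positivity) (Finset.sum_nonneg fun k _ => ?_)) hD.le
    refine mul_nonneg (by positivity) ?_
    have h1 := Nc_mono (c := c) hq (show (0:ℤ) ≤ 0 + 2 * p * k by positivity)
    rw [Nc_low hc (i := 0) (by omega) (by omega)] at h1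
    exact_mod_cast h1

lemma Nc_inj {q c c' : ℕ} (hc : c < q) (hc' : c' < q) (h : Nc q c = Nc q c') : c = c' := by
  have key : ∀ c c' : ℕ, c < q → c' < q → Nc q c = Nc q c' → c' ≤ c := by
    intro c c' hc hc' h
    by_contra hlt
    have h1 := Nc_high hc (i := 2 * c + 1) (by omega) (by omega)
    rw [h, Nc_low hc' (by omega) (by omega)] at h1
    omega
  exact le_antisymm (key c' c hc' hc h.symm) (key c c' hc hc' h)

lemma Cfg.exists_c {p q : ℕ} {x : ℤ → ℝ} {N : ℤ → ℤ} (hq : 1 ≤ q) (hpq : p < q)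
    (hcop : Nat.Coprime p q) (h : Cfg p q x N) : ∃ c, c < q ∧ x = xc p q c := by
  have Nper1 : ∀ i, N (i + 2 * q) = N i + 2 := by
    intro i
    have h1 := h.eqn i
    have h2 := h.eqn (i + 2 * q)
    have h3 := h.per i
    have h4 := h.per (i + 2 * p)
    rw [show i + 2 * q + 2 * p = i + 2 * p + 2 * q by ring] at h2
    have : (N (i + 2 * q) : ℝ) = N i + 2 := by linarith
    exact_mod_cast this
  have hgap : ∀ i, x (i + 1) - x i ≤ 1 := by
    intro i
    have := h.mono.monotone (show i + 1 ≤ i + 2 * q by omega)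
    rw [h.per] at this; linarith
  have hgap0 : ∀ i, 0 < x (i + 1) - x i := by
    intro i
    linarith [h.mono (show i < i + 1 by omega)]
  have hge : ∀ i, 3 * (x (i + 1) - x i) = (x (i + 2 * p + 1) - x (i + 2 * p)) + (N (i + 1) - N i) := by
    intro i
    have h1 := h.eqn i
    have h2 := h.eqn (i + 1)
    rw [show i + 1 + 2 * p = i + 2 * p + 1 by ring] at h2
    linarith
  have Nstep : ∀ i, N i ≤ N (i + 1) := by
    intro i
    have h1 := hge i
    have h2 := hgap0 i
    have h3 := hgap (i + 2 * p)
    have : (N i : ℝ) < N (i + 1) + 1 := by linarith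
    have : N i < N (i + 1) + 1 := by exact_mod_cast this
    omega
  have Nmono : Monotone N := monotone_int_of_le_succ Nstep
  have Nper : ∀ i n : ℤ, N (i + 2 * q * n) = N i + 2 * n := by
    intro i n
    have := per_int (m := 2 * q) (x := fun i => (N i : ℝ) / 2) (by intro i; rw [Nper1]; push_cast; ring) i n
    have : (N (i + 2 * q * n) : ℝ) = N i + 2 * n := by linarith
    exact_mod_cast this
  have hN0 : 0 ≤ N 0 := by
    have h1 := h.eqn 0
    have h2 := h.mono (show (0:ℤ) + 2 * p < 0 + 2 * q by omega)
    rw [h.per] at h2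
    have : (-1 : ℝ) < N 0 := by linarith [h.nonneg]
    have : -1 < N 0 := by exact_mod_cast this
    omega
  have hN1 : N (2 * q - 1) ≤ 1 := by
    have h1 := h.eqn (-1)
    have h2 := h.mono.monotone (show (-1:ℤ) ≤ -1 + 2 * p by omega)
    have : (N (-1) : ℝ) < 0 := by linarith [h.neg]
    have : N (-1) < 0 := by exact_mod_cast this
    have h3 := Nper1 (-1)
    rw [show (-1:ℤ) + 2 * q = 2 * q - 1 by ring] at h3
    omega
  have hex : ∃ k : ℕ, N (2 * p * k) < N (2 * p * k + 1) := by
    by_contra hno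
    push Not at hno
    have hk : ∀ k : ℕ, x (2 * p * k + 1) - x (2 * p * k) = 3 ^ k * (x 1 - x 0) := by
      intro k
      induction k with
      | zero => simp
      | succ k ih =>
        have h1 := hge (2 * p * k)
        have h2 : N (2 * p * k + 1) = N (2 * p * k) := le_antisymm (hno k) (Nstep _)
        rw [h2] at h1
        have e : (2 * p * ((k + 1 : ℕ) : ℤ)) = 2 * p * k + 2 * p := by push_cast; ring
        rw [e, pow_succ]
        linarith
    have h1 := hk q
    have h2 := per_int h.per 1 p
    have h3 := per_int h.per 0 p
    rw [show (2 * p * q + 1 : ℤ) = 1 + 2 * q * p by ring, h2,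
      show (2 * p * q : ℤ) = 0 + 2 * q * p by ring, h3] at h1
    have h4 := three_pow_pos hq
    have h5 := hgap0 0
    rw [zero_add] at h5
    nlinarith
  obtain ⟨k, hk⟩ := hex
  have hqz : (0:ℤ) < q := by exact_mod_cast hq
  have r0 := Int.emod_nonneg ((p:ℤ) * k) hqz.ne'
  have r1 := Int.emod_lt_of_pos ((p:ℤ) * k) hqz
  have r2 := Int.emod_add_mul_ediv ((p:ℤ) * k) q
  obtain ⟨c, hc⟩ := Int.eq_ofNat_of_zero_le r0
  rw [hc] at r1 r2
  have hcq : c < q := by exact_mod_cast r1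
  have j0 : N (2 * c) < N (2 * c + 1) := by
    have a := Nper (2 * c) (p * k / q)
    have b := Nper (2 * c + 1) (p * k / q)
    rw [show (2 * c : ℤ) + 2 * q * (p * k / q) = 2 * p * k by linear_combination 2 * r2] at a
    rw [show (2 * c : ℤ) + 1 + 2 * q * (p * k / q) = 2 * p * k + 1 by linear_combination 2 * r2] at b
    omega
  have a1 := Nmono (show (0:ℤ) ≤ 2 * c by omega)
  have a2 := Nmono (show (2 * c + 1 :ℤ) ≤ 2 * q - 1 by omega)
  have hNN : ∀ i, N i = Nc q c i := by
    intro i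
    have hq2 : (0:ℤ) < 2 * q := by omega
    have s0 := Int.emod_nonneg i hq2.ne'
    have s1 := Int.emod_lt_of_pos i hq2
    have s2 := Int.emod_add_mul_ediv i (2 * q)
    rw [← s2, Nper, Nc_per hq]
    congr 1
    generalize i % (2 * q) = r at *
    by_cases hr : r ≤ 2 * c
    · rw [Nc_low hcq s0 hr]
      have := Nmono s0
      have := Nmono hr
      omega
    · rw [Nc_high hcq (by omega) s1]
      have := Nmono (show 2 * c + 1 ≤ r by omega)
      have := Nmono (show r ≤ 2 * q - 1 by omega)
      omega
  refine ⟨c, hcq, ?_⟩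
  have h' := cfg_c hq hpq hcop hcq
  funext i
  have hk : ∀ k : ℕ, x (i + 2 * p * k) - xc p q c (i + 2 * p * k) = 3 ^ k * (x i - xc p q c i) := by
    intro k
    induction k with
    | zero => simp
    | succ k ih =>
      have b1 := h.eqn (i + 2 * p * k)
      have b2 := h'.eqn (i + 2 * p * k)
      rw [hNN] at b1
      have e : (i + 2 * p * ((k + 1 : ℕ) : ℤ)) = i + 2 * p * k + 2 * p := by push_cast; ring
      rw [e, pow_succ]
      linarith
  have c1 := hk q
  rw [show (i + 2 * p * q : ℤ) = i + 2 * q * p by ring, per_int h.per, per_int h'.per] at c1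
  have c2 := three_pow_pos hq
  have : (3 ^ q - 1) * (x i - xc p q c i) = 0 := by linarith
  rcases mul_eq_zero.1 this with h | h <;> linarith

lemma md_coe (y : ℝ) : md 3 (y : Circle1) = ((3 * y : ℝ) : Circle1) := by
  unfold md
  rw [← AddCircle.coe_nsmul]; simp

lemma floor_exists {m : ℤ} {x : ℤ → ℝ} (hx : StrictMono x) (h : ∀ i, x (i + m) = x i + 1) (y : ℝ) :
    ∃ i, x i ≤ y ∧ y < x (i + 1) := by
  have h1 : ∃ b : ℤ, ∀ z, x z ≤ y → z ≤ b := by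
    obtain ⟨n, hn⟩ := exists_int_gt (y - x 0)
    refine ⟨0 + m * n, fun z hz => ?_⟩
    have := per_int h 0 n
    exact (hx.lt_iff_lt.1 (show x z < x (0 + m * n) by linarith)).le
  have h2 : ∃ z, x z ≤ y := by
    obtain ⟨n, hn⟩ := exists_int_lt (y - x 0)
    refine ⟨0 + m * n, ?_⟩
    have := per_int h 0 n
    linarith
  obtain ⟨i, hi, hmax⟩ := Int.exists_greatest_of_bdd h1 h2
  refine ⟨i, hi, ?_⟩
  by_contra hlt
  have := hmax (i + 1) (not_lt.1 hlt)
  omega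

lemma Cfg.iter {s : ℤ} {x : ℤ → ℝ} (h : ∀ i, md 3 (x i : Circle1) = (x (i + s) : Circle1))
    (i : ℤ) (k : ℕ) : (md 3)^[k] (x i : Circle1) = (x (i + s * k) : Circle1) := by
  induction k with
  | zero => simp
  | succ k ih =>
    rw [Function.iterate_succ_apply', ih, h]
    congr 2; push_cast; ring

lemma Cfg.md {p q : ℕ} {x : ℤ → ℝ} {N : ℤ → ℤ} (h : Cfg p q x N) (i : ℤ) :
    md 3 (x i : Circle1) = (x (i + 2 * p) : Circle1) := by
  rw [md_coe, circ_eq_iff]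
  exact ⟨N i, h.eqn i⟩

lemma coe_per {m : ℤ} {x : ℤ → ℝ} (h : ∀ i, x (i + m) = x i + 1) (i n : ℤ) :
    (x (i + m * n) : Circle1) = (x i : Circle1) := by
  rw [circ_eq_iff]; exact ⟨n, per_int h i n⟩

lemma Cfg.isRot {p q : ℕ} {x : ℤ → ℝ} {N : ℤ → ℤ} (hq : 1 ≤ q)
    (hcop : Nat.Coprime p q) (h : Cfg p q x N) :
    IsRotationSetWith 3 (Set.range fun i => (x i : Circle1)) ((((p : ℝ) / (q : ℝ)) : ℝ) : Circle1) ∧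
        ∃ C C' : Set Circle1, IsPeriodicOrbit 3 C ∧ IsPeriodicOrbit 3 C' ∧
          C ≠ C' ∧ (Set.range fun i => (x i : Circle1)) = C ∪ C' := by
  let O : ℤ → Set Circle1 := fun i => Set.range (fun k : Fin q => (_root_.md 3)^[(k : ℕ)] (x i : Circle1))
  have hO : ∀ i, IsPeriodicOrbit 3 (O i) := by
    intro i
    refine ⟨x i, q, hq, ?_, rfl⟩
    rw [Cfg.iter h.md, show i + 2 * (p:ℤ) * q = i + 2 * q * p by ring, coe_per h.per]
  have hmem : ∀ i j, (x j : Circle1) ∈ O i ↔ (2:ℤ) ∣ j - i := by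
    intro i j
    constructor
    · rintro ⟨k, hk⟩
      simp only at hk
      rw [Cfg.iter h.md, circ_eq_iff] at hk
      obtain ⟨n, hn⟩ := hk
      rw [← per_int h.per] at hn
      have := h.mono.injective hn
      exact ⟨p * k - q * n, by linear_combination -this⟩
    · rintro ⟨r, hr⟩
      obtain ⟨k, hk, l, hl⟩ := cop_hit hq hcop r
      refine ⟨⟨k, hk⟩, ?_⟩
      simp only
      rw [Cfg.iter h.md, ← coe_per h.per _ l]
      congr 2
      linear_combination - hr - 2 * hl
  have hOs : ∀ i, O i ⊆ Set.range fun i => (x i : Circle1) := by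
    rintro i _ ⟨k, rfl⟩
    simp only
    rw [Cfg.iter h.md]
    exact ⟨_, rfl⟩
  have hU : (Set.range fun i => (x i : Circle1)) = O 0 ∪ O 1 := by
    apply Set.Subset.antisymm
    · rintro _ ⟨j, rfl⟩
      simp only [Set.mem_union, hmem]
      omega
    · exact Set.union_subset (hOs 0) (hOs 1)
  refine ⟨⟨⟨_, ⟨0, rfl⟩⟩, ?_, ?_, ?_⟩, O 0, O 1, hO 0, hO 1, ?_, hU⟩
  · rw [hU]
    exact ((Set.finite_range _).union (Set.finite_range _)).isCompact
  · apply Set.Subset.antisymm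
    · rintro _ ⟨_, ⟨i, rfl⟩, rfl⟩
      simp only
      rw [h.md]
      exact ⟨_, rfl⟩
    · rintro _ ⟨i, rfl⟩
      refine ⟨_, ⟨i - 2 * p, rfl⟩, ?_⟩
      simp only
      rw [h.md]
      congr 2; ring
  · choose f hf1 hf2 using floor_exists h.mono h.per
    have fle : ∀ y i, x i ≤ y → i ≤ f y := by
      intro y i hi
      have := h.mono.lt_iff_lt.1 (lt_of_le_of_lt hi (hf2 y))
      omega
    have fx : ∀ i, f (x i) = i := by
      intro i
      have := h.mono.le_iff_le.1 (hf1 (x i))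
      have := fle _ i le_rfl
      omega
    have fmono : Monotone f := fun a b hab => fle _ _ ((hf1 a).trans hab)
    have f1 : ∀ y, f (y + 1) = f y + 2 * q := by
      intro y
      apply le_antisymm
      · have a := hf1 (y + 1)
        have b := h.per (f (y + 1) - 2 * q)
        rw [sub_add_cancel] at b
        have := fle y (f (y + 1) - 2 * q) (by linarith)
        omega
      · apply fle
        rw [h.per]; linarith [hf1 y]
    let G : CircleDeg1Lift :=
      { toFun := fun y => x (f y + 2 * p)
        monotone' := fun a b hab => h.mono.monotone (by linarith [fmono hab])
        map_add_one' := fun y => by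
          rw [f1, ← h.per]; congr 1; ring }
    have hG : ∀ y, G y = x (f y + 2 * p) := fun y => rfl
    have hGx : ∀ i, G (x i) = x (i + 2 * p) := fun i => by rw [hG, fx]
    have hlift : IsLift (fun t => ((G (AddCircle.equivIco 1 0 t : ℝ) : ℝ) : Circle1)) G := by
      intro y
      obtain ⟨n, hn⟩ := (circ_eq_iff (AddCircle.equivIco 1 0 (y : Circle1) : ℝ) y).1
        AddCircle.coe_equivIco
      simp only
      rw [hn, circ_eq_iff]
      exact ⟨n, by simp⟩
    refine ⟨_, ?_, G, hlift, ?_⟩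
    · rintro _ ⟨i, rfl⟩
      exact (hlift (x i)).trans (by rw [hGx, h.md])
    · have hp : ∀ k : ℕ, (G ^ k) (x 0) = x (0 + 2 * p * k) := by
        intro k
        induction k with
        | zero => simp
        | succ k ih =>
          rw [pow_succ', CircleDeg1Lift.mul_apply, ih, hGx]
          congr 1; push_cast; ring
      have h1 := hp q
      rw [show (0:ℤ) + 2 * p * q = 0 + 2 * q * p by ring, per_int h.per] at h1
      rw [CircleDeg1Lift.translationNumber_of_map_pow_eq_add_int G h1 hq]
      simp
  · intro he
    have h1 := (hmem 0 0).2 (by simp)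
    rw [he, hmem] at h1
    omega

lemma orbit_finite {C : Set Circle1} (h : IsPeriodicOrbit 3 C) : C.Finite := by
  obtain ⟨t, n, _, _, rfl⟩ := h
  exact Set.finite_range _

lemma exists_cfg {p q : ℕ} (hq : 1 ≤ q) (hcop : Nat.Coprime p q) {X : Set Circle1}
    (hX : IsRotationSetWith 3 X ((((p : ℝ) / (q : ℝ)) : ℝ) : Circle1))
    {C C' : Set Circle1} (hC : IsPeriodicOrbit 3 C) (hC' : IsPeriodicOrbit 3 C')
    (hne : C ≠ C') (hU : X = C ∪ C') :
    ∃ x N, Cfg p q x N ∧ X = Set.range fun i => (x i : Circle1) := by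
  obtain ⟨hXne, -, himg, g, hg, G, hlift, hrot⟩ := hX
  have hfin : X.Finite := by rw [hU]; exact (orbit_finite hC).union (orbit_finite hC')
  obtain ⟨m, x, hm, hmono, hper, hneg, hnn, hmem⟩ := enum_exists X hfin hXne
  have hXx : ∀ i, (x i : Circle1) ∈ X := fun i => (hmem _).2 ⟨i, rfl⟩
  have hXr : X = Set.range fun i => (x i : Circle1) := by
    apply Set.Subset.antisymm
    · intro t ht
      obtain ⟨y, rfl⟩ := QuotientAddGroup.mk_surjective t
      obtain ⟨i, hi⟩ := (hmem y).1 ht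
      exact ⟨i, by simp only [hi]⟩
    · rintro _ ⟨i, rfl⟩; exact hXx i
  have hinj : Set.InjOn (md 3) X := Set.injOn_of_ncard_image_eq (by rw [himg]) hfin
  have hGc : ∀ i, ((G (x i) : ℝ) : Circle1) = md 3 (x i : Circle1) := by
    intro i
    rw [← hlift, hg _ (hXx i)]
  have hφ : ∀ i, ∃ j, x j = G (x i) := by
    intro i
    rw [← hmem, hGc, ← himg]
    exact ⟨_, hXx i, rfl⟩
  choose φ hφ using hφ
  have φinj : Function.Injective φ := by
    intro i j hij
    have e : G (x i) = G (x j) := by rw [← hφ, ← hφ, hij]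
    have e2 := hinj (hXx i) (hXx j) (by rw [← hGc, ← hGc, e])
    obtain ⟨n, hn⟩ := (circ_eq_iff _ _).1 e2
    rw [hn, CircleDeg1Lift.map_add_int] at e
    have : (n : ℝ) = 0 := by linarith
    exact hmono.injective (by rw [hn, this, add_zero])
  have φmono : StrictMono φ := by
    refine Monotone.strictMono_of_injective ?_ φinj
    intro i j hij
    refine hmono.le_iff_le.1 ?_
    rw [hφ, hφ]
    exact G.monotone (hmono.monotone hij)
  have φsurj : Function.Surjective φ := by
    intro j
    have h1 := hXx j
    rw [← himg, hXr] at h1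
    obtain ⟨_, ⟨i, rfl⟩, hi⟩ := h1
    simp only at hi
    rw [← hGc, circ_eq_iff] at hi
    obtain ⟨n, hn⟩ := hi
    refine ⟨i + m * (-n), hmono.injective ?_⟩
    rw [hφ, per_int hper, CircleDeg1Lift.map_add_int, hn]
    push_cast; ring
  have hsh := shift_of φmono φsurj
  obtain ⟨s, hs⟩ : ∃ s, φ 0 = s := ⟨_, rfl⟩
  rw [hs] at hsh
  have hGx : ∀ i, G (x i) = x (i + s) := fun i => by rw [← hφ, hsh]
  have hτ : G.translationNumber = (s : ℝ) / m := by
    have hp : ∀ k : ℕ, (G ^ k) (x 0) = x (0 + s * k) := by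
      intro k
      induction k with
      | zero => simp
      | succ k ih =>
        rw [pow_succ', CircleDeg1Lift.mul_apply, ih, hGx]
        congr 1; push_cast; ring
    have h1 := hp m
    rw [show (0:ℤ) + s * m = 0 + m * s by ring, per_int hper] at h1
    exact CircleDeg1Lift.translationNumber_of_map_pow_eq_add_int G h1 hm
  rw [hτ, circ_eq_iff] at hrot
  obtain ⟨n, hn⟩ := hrot
  -- normalise the shift
  have hmR : (m : ℝ) ≠ 0 := by positivity
  have hqR : (q : ℝ) ≠ 0 := by positivity
  obtain ⟨s', hs'⟩ : ∃ s', s + m * n = s' := ⟨_, rfl⟩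
  have hmd : ∀ i, md 3 (x i : Circle1) = (x (i + s') : Circle1) := by
    intro i
    rw [← hGc, hGx, ← hs', ← add_assoc, coe_per hper]
  have hpm : (p : ℤ) * m = s' * q := by
    have : (p : ℝ) * m = s' * q := by
      rw [← hs']
      push_cast
      field_simp at hn
      linear_combination hn
    exact_mod_cast this
  have hcz : IsCoprime (q : ℤ) (p : ℤ) := (Nat.isCoprime_iff_coprime.mpr hcop : IsCoprime (p:ℤ) (q:ℤ)).symm
  obtain ⟨d, hd⟩ : (q : ℤ) ∣ m := hcz.dvd_of_dvd_mul_left ⟨s', by rw [hpm]; ring⟩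
  have hqz : (0:ℤ) < q := by exact_mod_cast hq
  have hmz : (0:ℤ) < m := by exact_mod_cast hm
  have hsd : s' = p * d := by
    rw [hd] at hpm
    have : (q : ℤ) * s' = q * (p * d) := by linear_combination -hpm
    exact mul_left_cancel₀ hqz.ne' this
  have hdpos : 0 < d := by
    rw [hd] at hmz
    exact pos_of_mul_pos_right hmz hqz.le
  have hcls : ∀ D : Set Circle1, IsPeriodicOrbit 3 D → D ⊆ X →
      ∃ i : ℤ, ∀ j, (x j : Circle1) ∈ D ↔ d ∣ j - i := by
    rintro D ⟨t, l, hl, hper', rfl⟩ hsub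
    have ht : t ∈ X := hsub ⟨⟨0, hl⟩, rfl⟩
    rw [hXr] at ht
    obtain ⟨i, rfl⟩ := ht
    refine ⟨i, fun j => ?_⟩
    constructor
    · rintro ⟨k, hk⟩
      simp only at hk
      rw [Cfg.iter hmd, circ_eq_iff] at hk
      obtain ⟨n, hn⟩ := hk
      rw [← per_int hper] at hn
      have := hmono.injective hn
      rw [hd, hsd] at this
      exact ⟨p * k - q * n, by linear_combination -this⟩
    · rintro ⟨r, hr⟩
      obtain ⟨k, hk, b, hb⟩ := cop_hit hq hcop r
      refine ⟨⟨k % l, Nat.mod_lt _ hl⟩, ?_⟩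
      simp only
      rw [Function.IsPeriodicPt.iterate_mod_apply hper', Cfg.iter hmd, ← coe_per hper _ b]
      congr 2
      rw [hd, hsd]
      linear_combination - hr - d * hb
  obtain ⟨i, hi⟩ := hcls C hC (by rw [hU]; exact Set.subset_union_left)
  obtain ⟨i', hi'⟩ := hcls C' hC' (by rw [hU]; exact Set.subset_union_right)
  have hii : ¬ d ∣ i' - i := by
    intro hdv
    apply hne
    have hCX : C ⊆ X := by rw [hU]; exact Set.subset_union_left
    have hCX' : C' ⊆ X := by rw [hU]; exact Set.subset_union_right
    rw [hXr] at hCX hCX'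
    apply Set.Subset.antisymm
    · intro t ht
      obtain ⟨j, rfl⟩ := hCX ht
      simp only at ht ⊢
      rw [hi] at ht; rw [hi']
      have := dvd_sub ht hdv
      rwa [show j - i - (i' - i) = j - i' by ring] at this
    · intro t ht
      obtain ⟨j, rfl⟩ := hCX' ht
      simp only at ht ⊢
      rw [hi'] at ht; rw [hi]
      have := dvd_add ht hdv
      rwa [show j - i' + (i' - i) = j - i by ring] at this
  have hall : ∀ j, d ∣ j - i ∨ d ∣ j - i' := by
    intro j
    have := hXx j
    rw [hU, Set.mem_union, hi, hi'] at this
    exact this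
  have hd2 : d = 2 := by
    have h1 : d ≠ 1 := by rintro rfl; exact hii (one_dvd _)
    by_contra h2
    have h3 : 3 ≤ d := by omega
    have small : ∀ e : ℤ, 0 < e → e < 3 → ¬ d ∣ e := fun e h0 h1 hdv => by
      have := Int.le_of_dvd h0 hdv; omega
    have a1 : d ∣ (i + 1) - i' := (hall (i + 1)).resolve_left (by
      rw [show i + 1 - i = 1 by ring]; exact small 1 (by norm_num) (by norm_num))
    have a2 : d ∣ (i + 2) - i' := (hall (i + 2)).resolve_left (by
      rw [show i + 2 - i = 2 by ring]; exact small 2 (by norm_num) (by norm_num))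
    have := dvd_sub a2 a1
    rw [show i + 2 - i' - (i + 1 - i') = 1 by ring] at this
    exact small 1 (by norm_num) (by norm_num) this
  subst hd2
  have hN : ∀ i, ∃ N : ℤ, 3 * x i = x (i + 2 * p) + N := by
    intro i
    have := hmd i
    rw [md_coe, circ_eq_iff, hsd, mul_comm] at this
    simpa [mul_comm] using this
  choose N hN using hN
  exact ⟨x, N, ⟨hmono, fun i => by rw [← hper, hd]; congr 1; ring, hN, hneg, hnn⟩, hXr⟩
/-- For a reduced fraction `p/q` there are exactly `q` rotation sets for
`m_3` with rotation number `p/q` which are unions of two distinct periodic orbits. -/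
theorem count_two_cycle_rotation_sets_m3
    (p q : ℕ) (hq : 1 ≤ q) (hpq : p < q) (hcop : Nat.Coprime p q) :
    {X : Set Circle1 |
        IsRotationSetWith 3 X ((((p : ℝ) / (q : ℝ)) : ℝ) : Circle1) ∧
        ∃ C C' : Set Circle1, IsPeriodicOrbit 3 C ∧ IsPeriodicOrbit 3 C' ∧
          C ≠ C' ∧ X = C ∪ C'}.ncard = q := by
  have hset : {X : Set Circle1 |
        IsRotationSetWith 3 X ((((p : ℝ) / (q : ℝ)) : ℝ) : Circle1) ∧
        ∃ C C' : Set Circle1, IsPeriodicOrbit 3 C ∧ IsPeriodicOrbit 3 C' ∧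
          C ≠ C' ∧ X = C ∪ C'} =
      (fun c : ℕ => Set.range fun i => (xc p q c i : Circle1)) '' (Set.Iio q) := by
    apply Set.Subset.antisymm
    · rintro X ⟨hX, C, C', hC, hC', hne, hU⟩
      obtain ⟨x, N, hcfg, hr⟩ := exists_cfg hq hcop hX hC hC' hne hU
      obtain ⟨c, hc, rfl⟩ := hcfg.exists_c hq hpq hcop
      exact ⟨c, hc, hr.symm⟩
    · rintro _ ⟨c, hc, rfl⟩
      exact (cfg_c hq hpq hcop hc).isRot hq hcop
  rw [hset, Set.InjOn.ncard_image]
  · rw [← Finset.coe_Iio, Set.ncard_coe_finset]; simp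
  · intro c hc c' hc' he
    have h := cfg_c hq hpq hcop hc
    have h' := cfg_c hq hpq hcop hc'
    have key : ∀ {x y : ℤ → ℝ}, (∀ i, y (i + 2 * q) = y i + 1) →
        (Set.range fun i => (x i : Circle1)) = (Set.range fun i => (y i : Circle1)) →
        ∀ i, ∃ j, x i = y j := by
      intro x y hy hxy i
      have : (x i : Circle1) ∈ Set.range fun i => (y i : Circle1) := by
        rw [← hxy]; exact ⟨i, rfl⟩
      obtain ⟨j, hj⟩ := this
      obtain ⟨n, hn⟩ := (circ_eq_iff _ _).1 hj.symm
      exact ⟨j + 2 * q * n, by rw [per_int hy, hn]⟩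
    have hx : xc p q c = xc p q c' := by
      refine enum_unique h.mono h'.mono (key h'.per he) ?_ h.neg h.nonneg h'.neg h'.nonneg
      intro j
      obtain ⟨i, hi⟩ := key h.per he.symm j
      exact ⟨i, hi.symm⟩
    refine Nc_inj hc hc' ?_
    funext i
    have e1 := h.eqn i
    have e2 := h'.eqn i
    rw [hx] at e1
    have : (Nc q c i : ℝ) = Nc q c' i := by linarith
    exact_mod_cast this
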